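/- Let (R_n(x))_{n≥1} be the sequence of real polynomials defined by R_{n+1}(x) = (nx^2+1)·R_n(x) + x(1−x^2)·R_n′(x) with R_1(x) = 1+x. Then for every n ≥ 1, R_n(x) = W̄_n(x^2) + x·W_n(x^2). -/

import Mathlib

open Polynomial Finset

/-- The value `π(i)` of a permutation of `[n]` at position `i ∈ [n]`
(1-indexed), with the convention `π(0) = 0`. -/
def pval (n : ℕ) (π : Equiv.Perm (Fin n)) (i : ℕ) : ℤ :=
  if h : 1 ≤ i ∧ i ≤ n then ((π ⟨i - 1, by omega⟩ : Fin n).val + 1 : ℤ) else 0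

/-- The interior peak number
`ipk(π) = #{i ∈ [2, n-1] : π(i-1) < π(i) > π(i+1)}`. -/
def ipk (n : ℕ) (π : Equiv.Perm (Fin n)) : ℕ :=
  ((Finset.Icc 2 (n - 1)).filter
    (fun i => pval n π (i - 1) < pval n π i ∧ pval n π (i + 1) < pval n π i)).card

/-- The left peak number
`lpk(π) = #{i ∈ [n-1] : π(i-1) < π(i) > π(i+1)}` with `π(0) = 0`. -/
def lpk (n : ℕ) (π : Equiv.Perm (Fin n)) : ℕ :=
  ((Finset.Icc 1 (n - 1)).filter
    (fun i => pval n π (i - 1) < pval n π i ∧ pval n π (i + 1) < pval n π i)).card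

/-- The interior peak polynomial `W_n(x) = Σ_{π ∈ S_n} x^{ipk(π)}`. -/
noncomputable def Wpoly (n : ℕ) : Polynomial ℝ :=
  ∑ π : Equiv.Perm (Fin n), X ^ ipk n π

/-- The left peak polynomial `W̄_n(x) = Σ_{π ∈ S_n} x^{lpk(π)}`. -/
noncomputable def Wbarpoly (n : ℕ) : Polynomial ℝ :=
  ∑ π : Equiv.Perm (Fin n), X ^ lpk n π

/-- The number of up-down runs of `π`, i.e. the number of maximal monotone
consecutive blocks of the sequence `0, π(1), …, π(n)`.  Since consecutive
entries of this sequence are distinct, for `n ≥ 1` this number equals one plus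
the number of interior direction changes (peaks or valleys) of the sequence. -/
def udrun (n : ℕ) (π : Equiv.Perm (Fin n)) : ℕ :=
  if n = 0 then 0
  else
    1 + ((Finset.Icc 1 (n - 1)).filter
      (fun i =>
        (pval n π (i - 1) < pval n π i ∧ pval n π (i + 1) < pval n π i) ∨
        (pval n π i < pval n π (i - 1) ∧ pval n π i < pval n π (i + 1)))).card

/-- The up-down run polynomial `T_n(x) = Σ_{π ∈ S_n} x^{udrun(π)}`. -/
noncomputable def Tpoly (n : ℕ) : Polynomial ℝ :=
  ∑ π : Equiv.Perm (Fin n), X ^ udrun n π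

/-- `T_n^E(x) = Σ_{π ∈ S_n, π(n-1) > π(n)} x^{lpk(π)}` (with `π(0) = 0`). -/
noncomputable def TEpoly (n : ℕ) : Polynomial ℝ :=
  ∑ π ∈ Finset.univ.filter
      (fun π : Equiv.Perm (Fin n) => pval n π n < pval n π (n - 1)),
    X ^ lpk n π

/-- `T_n^O(x) = Σ_{π ∈ S_n, π(n-1) < π(n)} x^{lpk(π)}` (with `π(0) = 0`). -/
noncomputable def TOpoly (n : ℕ) : Polynomial ℝ :=
  ∑ π ∈ Finset.univ.filter
      (fun π : Equiv.Perm (Fin n) => pval n π (n - 1) < pval n π n),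
    X ^ lpk n π

/-- The peaks of the sequence `a` at positions in `[m, n - 1]`. -/
def peakSet (m n : ℕ) (a : ℕ → ℤ) : Finset ℕ :=
  (Finset.Icc m (n - 1)).filter (fun i => a (i - 1) < a i ∧ a (i + 1) < a i)

/-- The sequence `a` with the value `M` inserted at position `p`. -/
def insertSeq (a : ℕ → ℤ) (p : ℕ) (M : ℤ) (i : ℕ) : ℤ :=
  if i < p then a i else if i = p then M else a (i - 1)

/-- The positions at which inserting a new maximum into `a` creates a new peak. -/
def newPeakSlots (m n : ℕ) (a : ℕ → ℤ) : Finset ℕ :=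
  Finset.Icc m n \ (peakSet m n a ∪ (peakSet m n a).image (· + 1))

lemma mem_peakSet {m n : ℕ} {a : ℕ → ℤ} {i : ℕ} :
    i ∈ peakSet m n a ↔ (m ≤ i ∧ i ≤ n - 1) ∧ a (i - 1) < a i ∧ a (i + 1) < a i := by
  simp [peakSet]

lemma mem_newPeakSlots {m n : ℕ} {a : ℕ → ℤ} {p : ℕ} (hp : 1 ≤ p) :
    p ∈ newPeakSlots m n a ↔
      (m ≤ p ∧ p ≤ n) ∧ p ∉ peakSet m n a ∧ p - 1 ∉ peakSet m n a := by
  have h : (∃ i ∈ peakSet m n a, i + 1 = p) ↔ p - 1 ∈ peakSet m n a := by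
    constructor
    · rintro ⟨i, hi, rfl⟩
      simpa using hi
    · intro hi
      exact ⟨p - 1, hi, by omega⟩
  simp only [newPeakSlots, mem_sdiff, mem_Icc, mem_union, mem_image, h, not_or]

lemma succ_notMem_peakSet {m n : ℕ} {a : ℕ → ℤ} {i : ℕ} (hi : i ∈ peakSet m n a) :
    i + 1 ∉ peakSet m n a := by
  rw [mem_peakSet] at *
  rintro ⟨-, h, -⟩
  simp only [Nat.add_sub_cancel] at h
  omega

lemma card_newPeakSlots {m n : ℕ} {a : ℕ → ℤ} (hm : 1 ≤ m) (hmn : m ≤ n + 1) :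
    (newPeakSlots m n a).card + 2 * (peakSet m n a).card + m = n + 1 := by
  have hdisj : Disjoint (peakSet m n a) ((peakSet m n a).image (· + 1)) := by
    rw [Finset.disjoint_left]
    intro i hi hi'
    obtain ⟨j, hj, rfl⟩ := mem_image.1 hi'
    exact succ_notMem_peakSet hj hi
  have hsub : peakSet m n a ∪ (peakSet m n a).image (· + 1) ⊆ Finset.Icc m n := by
    intro i hi
    rw [mem_union, mem_image] at hi
    rw [mem_Icc]
    rcases hi with hi | ⟨j, hi, rfl⟩
    all_goals
      rw [mem_peakSet] at hi
      omega
  have hcard := Finset.card_sdiff_add_card_eq_card hsub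
  rw [card_union_of_disjoint hdisj, card_image_of_injective _ (add_left_injective 1),
    Nat.card_Icc] at hcard
  unfold newPeakSlots
  omega

lemma peakSet_insertSeq {m n p : ℕ} {a : ℕ → ℤ} {M : ℤ} (hm : 1 ≤ m) (hm' : m ≤ 2)
    (ha : ∀ i ≤ n, a i < M) (hp : 1 ≤ p) (hpn : p ≤ n + 1) :
    peakSet m (n + 1) (insertSeq a p M) =
      (((peakSet m n a).erase p).erase (p - 1)).image (fun i => if i < p then i else i + 1) ∪
        (if m ≤ p ∧ p ≤ n then {p} else ∅) := by
  ext j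
  have e1 : insertSeq a p M p = M := by simp [insertSeq]
  have elt : ∀ i, i < p → insertSeq a p M i = a i := fun i hi => by simp [insertSeq, hi]
  have egt : ∀ i, p < i → insertSeq a p M i = a (i - 1) := fun i hi => by
    simp [insertSeq, hi.ne', hi.le]
  have himg : j ∈ (((peakSet m n a).erase p).erase (p - 1)).image
      (fun i => if i < p then i else i + 1) ↔
      (j + 1 < p ∧ j ∈ peakSet m n a) ∨ (p + 1 < j ∧ j - 1 ∈ peakSet m n a) := by
    simp only [mem_image, mem_erase]
    constructor
    · rintro ⟨i, ⟨h1, h2, h3⟩, rfl⟩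
      split_ifs with h
      · exact Or.inl ⟨by omega, h3⟩
      · exact Or.inr ⟨by omega, by simpa using h3⟩
    · rintro (⟨h1, h2⟩ | ⟨h1, h2⟩)
      · exact ⟨j, ⟨by omega, by omega, h2⟩, if_pos (by omega)⟩
      · refine ⟨j - 1, ⟨by omega, by omega, h2⟩, ?_⟩
        rw [if_neg (by omega)]
        omega
  have hsing : j ∈ (if m ≤ p ∧ p ≤ n then ({p} : Finset ℕ) else ∅) ↔
      j = p ∧ m ≤ p ∧ p ≤ n := by
    split_ifs with h <;> simp [h]
  rw [mem_union, himg, hsing]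
  simp only [mem_peakSet, Nat.add_sub_cancel]
  rcases lt_trichotomy j p with hj | rfl | hj
  · rw [elt j hj, elt (j - 1) (by omega)]
    rcases Nat.lt_or_ge (j + 1) p with hj' | hj'
    · rw [elt _ hj']
      omega
    · obtain rfl : p = j + 1 := by omega
      rw [e1]
      have := ha j (by omega)
      omega
  · rw [e1, elt _ (by omega), egt _ (by omega)]
    simp only [Nat.add_sub_cancel, true_and]
    have := ha (j - 1) (by omega)
    by_cases hjn : j ≤ n
    · have := ha j hjn
      omega
    · omega
  · rw [egt j hj, egt (j + 1) (by omega)]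
    rcases Nat.lt_or_ge (p + 1) j with hj' | hj'
    · rw [egt _ (by omega), Nat.add_sub_cancel, Nat.sub_add_cancel (by omega : 1 ≤ j)]
      omega
    · obtain rfl : j = p + 1 := by omega
      rw [Nat.add_sub_cancel, e1]
      have := ha p
      omega

lemma card_peakSet_insertSeq {m n p : ℕ} {a : ℕ → ℤ} {M : ℤ} (hm : 1 ≤ m) (hm' : m ≤ 2)
    (ha : ∀ i ≤ n, a i < M) (hp : 1 ≤ p) (hpn : p ≤ n + 1) :
    (peakSet m (n + 1) (insertSeq a p M)).card =
      (peakSet m n a).card + if p ∈ newPeakSlots m n a then 1 else 0 := by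
  rw [peakSet_insertSeq hm hm' ha hp hpn, card_union_of_disjoint, card_image_of_injective]
  · have hadj : p - 1 ∈ peakSet m n a → p ∉ peakSet m n a := by
      intro h
      have := succ_notMem_peakSet h
      rwa [Nat.sub_add_cancel hp] at this
    have hpos : ∀ i, i ∈ peakSet m n a → 0 < (peakSet m n a).card :=
      fun i hi => card_pos.2 ⟨i, hi⟩
    have hrange : ∀ i, i ∈ peakSet m n a → m ≤ i ∧ i ≤ n - 1 := fun i hi => (mem_peakSet.1 hi).1
    have h1 := hrange p
    have h2 := hrange (p - 1)
    have h3 := hpos p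
    have h4 := hpos (p - 1)
    simp only [mem_newPeakSlots hp, card_erase_eq_ite, mem_erase]
    have hne : p - 1 ≠ p := by omega
    rw [apply_ite card, card_singleton, card_empty]
    simp only [hne, ne_eq, not_false_eq_true, true_and]
    by_cases c1 : p ∈ peakSet m n a <;> by_cases c2 : p - 1 ∈ peakSet m n a <;>
      by_cases c3 : m ≤ p ∧ p ≤ n <;> simp only [c1, c2, c3] <;> grind
  · intro i j hij
    dsimp only at hij
    split_ifs at hij <;> omega
  · rw [Finset.disjoint_left]
    intro i hi hi'
    obtain ⟨j, -, rfl⟩ := mem_image.1 hi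
    split_ifs at hi' <;> simp at hi' <;> omega

lemma sum_pow_card_peakSet_insertSeq {m n : ℕ} {a : ℕ → ℤ} {M : ℤ} (hm : 1 ≤ m) (hm' : m ≤ 2)
    (hn : 1 ≤ n) (ha : ∀ i ≤ n, a i < M) :
    ∑ p : Fin (n + 1), (X : ℝ[X]) ^ (peakSet m (n + 1) (insertSeq a (p + 1) M)).card =
      ((m : ℝ[X]) + ((n : ℝ[X]) + 1 - (m : ℝ[X])) * X) * X ^ (peakSet m n a).card +
        2 * X * (1 - X) * derivative (X ^ (peakSet m n a).card) := by
  set k := (peakSet m n a).card with hk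
  have hB : (newPeakSlots m n a).card + 2 * k + m = n + 1 := card_newPeakSlots hm (by omega)
  have hterm : ∀ p : Fin (n + 1),
      (X : ℝ[X]) ^ (peakSet m (n + 1) (insertSeq a (p + 1) M)).card =
        X ^ k + (if (p : ℕ) + 1 ∈ newPeakSlots m n a then X ^ (k + 1) - X ^ k else 0) := by
    intro p
    rw [card_peakSet_insertSeq hm hm' ha (by omega) (by omega)]
    split_ifs <;> simp [hk]
  have hcount : ((Finset.range (n + 1)).filter (fun i => i + 1 ∈ newPeakSlots m n a)).card =
      (newPeakSlots m n a).card := by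
    refine card_bij (fun i _ => i + 1) ?_ ?_ ?_
    · intro i hi
      exact (mem_filter.1 hi).2
    · intro i _ j _ h
      omega
    · intro j hj
      have hj' := (mem_Icc.1 (mem_sdiff.1 hj).1)
      have hj1 : j - 1 + 1 = j := by omega
      exact ⟨j - 1, mem_filter.2 ⟨mem_range.2 (by omega), by rwa [hj1]⟩, hj1⟩
  have hderiv : (X : ℝ[X]) * derivative (X ^ k) = (k : ℝ[X]) * X ^ k := by
    rw [derivative_X_pow]
    rcases k with _ | k
    · simp
    · simp only [Nat.add_sub_cancel, map_natCast]
      ring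
  have hB' : ((newPeakSlots m n a).card : ℝ[X]) = n + 1 - m - 2 * k := by
    have : (((newPeakSlots m n a).card + 2 * k + m : ℕ) : ℝ[X]) = ((n + 1 : ℕ) : ℝ[X]) := by
      rw [hB]
    push_cast at this
    linear_combination this
  rw [Finset.sum_congr rfl (fun p _ => hterm p), Finset.sum_add_distrib,
    Fin.sum_univ_eq_sum_range
      (fun i => if i + 1 ∈ newPeakSlots m n a then (X : ℝ[X]) ^ (k + 1) - X ^ k else 0) (n + 1),
    ← Finset.sum_filter, Finset.sum_const,
    Finset.sum_const, hcount]
  simp only [card_univ, Fintype.card_fin, nsmul_eq_mul, hB']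
  push_cast
  linear_combination (-2 * (1 - X)) * hderiv

/-- The permutation of `Fin (n + 1)` obtained from `σ` by inserting the new maximum at
position `p`. -/
def insertMax {n : ℕ} (p : Fin (n + 1)) (σ : Equiv.Perm (Fin n)) : Equiv.Perm (Fin (n + 1)) :=
  ((finSuccEquiv' p).trans σ.optionCongr).trans (finSuccEquiv' (Fin.last n)).symm

lemma insertMax_self {n : ℕ} (p : Fin (n + 1)) (σ : Equiv.Perm (Fin n)) :
    insertMax p σ p = Fin.last n := by
  simp [insertMax]

lemma insertMax_succAbove {n : ℕ} (p : Fin (n + 1)) (σ : Equiv.Perm (Fin n)) (i : Fin n) :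
    insertMax p σ (p.succAbove i) = (σ i).castSucc := by
  simp [insertMax]

lemma insertMax_bijective (n : ℕ) :
    Function.Bijective (fun q : Equiv.Perm (Fin n) × Fin (n + 1) => insertMax q.2 q.1) := by
  rw [Fintype.bijective_iff_injective_and_card]
  constructor
  · rintro ⟨σ, p⟩ ⟨τ, q⟩ h
    dsimp only at h
    obtain rfl : p = q := by
      apply (insertMax p σ).injective
      rw [insertMax_self, h, insertMax_self]
    congr 1
    ext i
    have := insertMax_succAbove p τ i
    rw [← h, insertMax_succAbove] at this
    simpa [Fin.ext_iff] using this
  · simp [Fintype.card_perm, Nat.factorial_succ, mul_comm]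

lemma pval_insertMax {n : ℕ} (p : Fin (n + 1)) (σ : Equiv.Perm (Fin n)) :
    pval (n + 1) (insertMax p σ) = insertSeq (pval n σ) (p + 1) (n + 1) := by
  funext i
  rcases Nat.eq_zero_or_pos i with rfl | hi
  · simp [pval, insertSeq]
  rcases Nat.lt_or_ge (n + 1) i with hin | hin
  · have hp := p.isLt
    rw [insertSeq, if_neg (by omega), if_neg (by omega), pval, pval, dif_neg (by omega),
      dif_neg (by omega)]
  rw [pval, dif_pos ⟨hi, hin⟩]
  rcases lt_trichotomy i (p + 1) with h | rfl | h
  · have hidx : (⟨i - 1, by omega⟩ : Fin (n + 1)) = p.succAbove ⟨i - 1, by omega⟩ := by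
      rw [Fin.succAbove_of_castSucc_lt _ _ (by simp [Fin.lt_def]; omega)]
      rfl
    rw [hidx, insertMax_succAbove, insertSeq, if_pos h, pval, dif_pos (by omega)]
    rfl
  · simp [insertSeq, insertMax_self]
  · have hidx : (⟨i - 1, by omega⟩ : Fin (n + 1)) = p.succAbove ⟨i - 1 - 1, by omega⟩ := by
      rw [Fin.succAbove_of_le_castSucc _ _ (by simp [Fin.le_def]; omega)]
      ext
      simp
      omega
    rw [hidx, insertMax_succAbove, insertSeq, if_neg (by omega), if_neg (by omega), pval,
      dif_pos (by omega)]
    rfl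

lemma pval_lt (n : ℕ) (σ : Equiv.Perm (Fin n)) (i : ℕ) : pval n σ i < n + 1 := by
  unfold pval
  split_ifs
  · have := (σ ⟨i - 1, by omega⟩).isLt
    omega
  · omega

lemma sum_pow_card_peakSet_succ {m n : ℕ} (hm : 1 ≤ m) (hm' : m ≤ 2) (hn : 1 ≤ n) :
    ∑ π : Equiv.Perm (Fin (n + 1)), (X : ℝ[X]) ^ (peakSet m (n + 1) (pval (n + 1) π)).card =
      ((m : ℝ[X]) + ((n : ℝ[X]) + 1 - (m : ℝ[X])) * X) *
          ∑ σ : Equiv.Perm (Fin n), X ^ (peakSet m n (pval n σ)).card +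
        2 * X * (1 - X) *
          derivative (∑ σ : Equiv.Perm (Fin n), X ^ (peakSet m n (pval n σ)).card) := by
  rw [← (insertMax_bijective n).sum_comp, Fintype.sum_prod_type, derivative_sum, mul_sum, mul_sum,
    ← sum_add_distrib]
  refine sum_congr rfl fun σ _ => ?_
  simp only [pval_insertMax]
  exact sum_pow_card_peakSet_insertSeq hm hm' hn fun i _ => pval_lt n σ i

lemma Wbarpoly_succ {n : ℕ} (hn : 1 ≤ n) :
    Wbarpoly (n + 1) =
      (1 + (n : ℝ[X]) * X) * Wbarpoly n + 2 * X * (1 - X) * derivative (Wbarpoly n) := by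
  have h := sum_pow_card_peakSet_succ (m := 1) le_rfl (by norm_num) hn
  simp only [Nat.cast_one, add_sub_cancel_right] at h
  exact h

lemma Wpoly_succ {n : ℕ} (hn : 1 ≤ n) :
    Wpoly (n + 1) =
      (2 + ((n : ℝ[X]) - 1) * X) * Wpoly n + 2 * X * (1 - X) * derivative (Wpoly n) := by
  have h := sum_pow_card_peakSet_succ (m := 2) (by norm_num) le_rfl hn
  have h2 : (n : ℝ[X]) + 1 - (2 : ℕ) = n - 1 := by push_cast; ring
  rw [h2] at h
  exact h

/-- If `R_{n+1}(x) = (nx²+1)·R_n(x) + x(1-x²)·R_n'(x)` with `R_1(x) = 1+x`,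
then `R_n(x) = W̄_n(x²) + x·W_n(x²)` for every `n ≥ 1`. -/
theorem Rpoly_eq_Wbar_W (R : ℕ → Polynomial ℝ)
    (hR1 : R 1 = 1 + X)
    (hR : ∀ n : ℕ, 1 ≤ n →
      R (n + 1) = (Polynomial.C (n : ℝ) * X ^ 2 + 1) * R n +
        X * (1 - X ^ 2) * derivative (R n)) :
    ∀ n : ℕ, 1 ≤ n →
      R n = (Wbarpoly n).comp (X ^ 2) + X * (Wpoly n).comp (X ^ 2) := by
  intro n hn
  induction n, hn using Nat.le_induction with
  | base => simp [hR1, Wbarpoly, Wpoly, lpk, ipk]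
  | succ n hn ih =>
    rw [hR n hn, ih, Wbarpoly_succ hn, Wpoly_succ hn]
    simp only [derivative_add, derivative_mul, derivative_comp, derivative_X_pow, derivative_X,
      add_comp, mul_comp, sub_comp, one_comp, X_comp, natCast_comp, ofNat_comp, map_natCast]
    push_cast
    ring
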